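/- Let P be a simple polygon in the plane with vertices v_0, …, v_{n-1} (indices mod n), with no three distinct vertices collinear. If v_a, v_b, v_c are three distinct vertices of P that are mutually visible to each other (each pair is joined by a closed segment contained in P), then the solid triangle conv{v_a, v_b, v_c} is entirely contained in P. -/

import Mathlib

/-- A point in the Euclidean plane. -/
abbrev Plane := ℝ × ℝ

/-- A simple polygon with `n` vertices `v 0, …, v (n-1)` in counterclockwise order
(indices mod `n`), given as a compact region `P` of the plane that is the closure of its
interior, whose frontier is the union of the closed edge segments `[v i, v (i+1)]`,
such that consecutive edges meet exactly in their common endpoint and non-consecutive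
edges are disjoint; moreover no three distinct vertices are collinear. -/
structure SimplePolygon (n : ℕ) where
  three_le : 3 ≤ n
  v : ZMod n → Plane
  inj : Function.Injective v
  P : Set Plane
  compact : IsCompact P
  regular : P = closure (interior P)
  frontier_eq : frontier P = ⋃ i : ZMod n, segment ℝ (v i) (v (i + 1))
  edges_consecutive : ∀ i : ZMod n,
    segment ℝ (v i) (v (i + 1)) ∩ segment ℝ (v (i + 1)) (v (i + 1 + 1)) = {v (i + 1)}
  edges_disjoint : ∀ i j : ZMod n, i ≠ j → j ≠ i + 1 → i ≠ j + 1 →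
    Disjoint (segment ℝ (v i) (v (i + 1))) (segment ℝ (v j) (v (j + 1)))
  no_three_collinear : ∀ a b c : ZMod n, a ≠ b → a ≠ c → b ≠ c →
    ¬ Collinear ℝ ({v a, v b, v c} : Set Plane)

/-- `a` is visible to `b` in `P`: the closed segment `[a, b]` is contained in `P`. -/
def Visible (P : Set Plane) (a b : Plane) : Prop := segment ℝ a b ⊆ P

open Set Topology

/-- Twice the signed area of the triangle `p q x`. -/
def signedArea (p q x : Plane) : ℝ :=
  (q.1 - p.1) * (x.2 - p.2) - (q.2 - p.2) * (x.1 - p.1)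

lemma continuous_signedArea (p q : Plane) : Continuous (signedArea p q) := by
  unfold signedArea; fun_prop

lemma signedArea_swap (p q x : Plane) : signedArea q p x = -signedArea p q x := by
  unfold signedArea; ring

lemma signedArea_combo (p q x y : Plane) {s t : ℝ} (h : s + t = 1) :
    signedArea p q (s • x + t • y) = s * signedArea p q x + t * signedArea p q y := by
  obtain rfl : s = 1 - t := by linarith
  simp only [signedArea, Prod.fst_add, Prod.snd_add, Prod.smul_fst, Prod.smul_snd, smul_eq_mul]
  ring

lemma signedArea_eq_zero_of_mem_segment {p q x : Plane} (h : x ∈ segment ℝ p q) :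
    signedArea p q x = 0 := by
  obtain ⟨s, t, -, -, hst, rfl⟩ := h
  rw [signedArea_combo p q p q hst]
  unfold signedArea; ring

lemma sq_add_sq_pos_of_ne {p q : Plane} (hpq : p ≠ q) :
    0 < (q.1 - p.1) ^ 2 + (q.2 - p.2) ^ 2 := by
  by_contra! h
  apply hpq
  have h1 : q.1 - p.1 = 0 := by nlinarith [sq_nonneg (q.1 - p.1), sq_nonneg (q.2 - p.2)]
  have h2 : q.2 - p.2 = 0 := by nlinarith [sq_nonneg (q.1 - p.1), sq_nonneg (q.2 - p.2)]
  ext <;> linarith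

lemma exists_lt_signedArea {p q x : Plane} (hpq : p ≠ q) {U : Set Plane} (hU : U ∈ 𝓝 x) :
    ∃ y ∈ U, signedArea p q x < signedArea p q y := by
  set d : Plane := (-(q.2 - p.2), q.1 - p.1) with hd
  have hc : Continuous fun t : ℝ => x + t • d := by fun_prop
  have hev : ∀ᶠ t : ℝ in 𝓝[>] 0, x + t • d ∈ U := by
    apply (hc.tendsto 0).mono_left nhdsWithin_le_nhds
    simpa using hU
  obtain ⟨t, htU, ht⟩ := (hev.and self_mem_nhdsWithin).exists
  refine ⟨_, htU, ?_⟩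
  have hpos := sq_add_sq_pos_of_ne hpq
  have key : signedArea p q (x + t • d) =
      signedArea p q x + t * ((q.1 - p.1) ^ 2 + (q.2 - p.2) ^ 2) := by
    simp only [signedArea, hd, Prod.fst_add, Prod.snd_add, Prod.smul_fst, Prod.smul_snd,
      smul_eq_mul]
    ring
  rw [key]
  have := mul_pos ht hpos
  linarith

lemma exists_signedArea_ne_zero {p q : Plane} (hpq : p ≠ q) {U : Set Plane} (hU : IsOpen U)
    (hne : U.Nonempty) : ∃ y ∈ U, signedArea p q y ≠ 0 := by
  obtain ⟨x, hx⟩ := hne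
  by_cases h : signedArea p q x = 0
  · obtain ⟨y, hy, hlt⟩ := exists_lt_signedArea hpq (hU.mem_nhds hx)
    exact ⟨y, hy, by rw [h] at hlt; exact hlt.ne'⟩
  · exact ⟨x, hx, h⟩

lemma mem_segment_of_signedArea_eq_zero {p q r x : Plane} (hD : 0 < signedArea p q r)
    (h0 : signedArea p q x = 0) (h1 : 0 ≤ signedArea q r x) (h2 : 0 ≤ signedArea r p x) :
    x ∈ segment ℝ p q := by
  have hsum : signedArea q r x + signedArea r p x = signedArea p q r := by
    have : signedArea p q x + signedArea q r x + signedArea r p x = signedArea p q r := by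
      unfold signedArea; ring
    linarith
  refine ⟨signedArea q r x / signedArea p q r, signedArea r p x / signedArea p q r,
    by positivity, by positivity, by rw [← add_div, hsum, div_self hD.ne'], ?_⟩
  have e1 : signedArea q r x * p.1 + signedArea r p x * q.1 + signedArea p q x * r.1
      = signedArea p q r * x.1 := by unfold signedArea; ring
  have e2 : signedArea q r x * p.2 + signedArea r p x * q.2 + signedArea p q x * r.2
      = signedArea p q r * x.2 := by unfold signedArea; ring
  rw [h0] at e1 e2
  ext
  · simp only [Prod.fst_add, Prod.smul_fst, smul_eq_mul]
    field_simp
    linarith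
  · simp only [Prod.snd_add, Prod.smul_snd, smul_eq_mul]
    field_simp
    linarith

lemma signedArea_ne_zero_of_not_collinear {p q r : Plane} (hpq : p ≠ q)
    (h : ¬ Collinear ℝ ({p, q, r} : Set Plane)) : signedArea p q r ≠ 0 := by
  intro h0
  apply h
  rw [collinear_iff_of_mem (p₀ := p) (by simp)]
  refine ⟨q - p, ?_⟩
  unfold signedArea at h0
  rintro x (rfl | rfl | rfl)
  · exact ⟨0, by simp⟩
  · exact ⟨1, by simp⟩
  · by_cases h1 : q.1 - p.1 = 0
    · have h2 : q.2 - p.2 ≠ 0 := by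
        intro h2; apply hpq; ext <;> linarith
      have h3 : x.1 - p.1 = 0 := by
        rw [h1] at h0
        have : (q.2 - p.2) * (x.1 - p.1) = 0 := by linarith
        exact (mul_eq_zero.mp this).resolve_left h2
      refine ⟨(x.2 - p.2) / (q.2 - p.2), ?_⟩
      ext
      · simp only [vadd_eq_add, Prod.fst_add, Prod.smul_fst, Prod.fst_sub, smul_eq_mul, h1]
        linarith
      · simp only [vadd_eq_add, Prod.snd_add, Prod.smul_snd, Prod.snd_sub, smul_eq_mul]
        field_simp
        ring
    · refine ⟨(x.1 - p.1) / (q.1 - p.1), ?_⟩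
      ext
      · simp only [vadd_eq_add, Prod.fst_add, Prod.smul_fst, Prod.fst_sub, smul_eq_mul]
        field_simp
        ring
      · simp only [vadd_eq_add, Prod.snd_add, Prod.smul_snd, Prod.snd_sub, smul_eq_mul]
        field_simp
        linarith

/-- The part of `B` strictly to the left of the line from `p` to `q`. -/
def leftPart (B : Set Plane) (p q : Plane) : Set Plane := B ∩ {x | 0 < signedArea p q x}

lemma convex_leftPart {B : Set Plane} (hB : Convex ℝ B) (p q : Plane) :
    Convex ℝ (leftPart B p q) := by
  refine hB.inter ?_
  intro x hx y hy s t hs ht hst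
  simp only [mem_ofPred_eq] at *
  rw [signedArea_combo p q x y hst]
  rcases hs.eq_or_lt with rfl | hs
  · obtain rfl : t = 1 := by linarith
    simpa using hy
  · have := mul_pos hs hx
    have := mul_nonneg ht hy.le
    linarith

lemma mem_leftPart_or_mem_leftPart_swap {B : Set Plane} {p q x : Plane} (hx : x ∈ B)
    (h : signedArea p q x ≠ 0) : x ∈ leftPart B p q ∨ x ∈ leftPart B q p := by
  rcases h.lt_or_gt with h | h
  · exact Or.inr ⟨hx, by simp only [mem_ofPred_eq, signedArea_swap p q]; linarith⟩
  · exact Or.inl ⟨hx, h⟩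

lemma disjoint_leftPart_segment (B : Set Plane) (p q : Plane) :
    Disjoint (leftPart B p q) (segment ℝ p q) :=
  disjoint_left.2 fun _ hx hxs => hx.2.ne' (signedArea_eq_zero_of_mem_segment hxs)

lemma mem_closure_leftPart {B : Set Plane} (hB : IsOpen B) {p q x : Plane} (hpq : p ≠ q)
    (hxB : x ∈ B) (hx : signedArea p q x = 0) : x ∈ closure (leftPart B p q) := by
  rw [mem_closure_iff_nhds]
  intro U hU
  obtain ⟨y, hy, hlt⟩ := exists_lt_signedArea hpq (Filter.inter_mem hU (hB.mem_nhds hxB))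
  exact ⟨y, hy.1, hy.2, by rw [hx] at hlt; exact hlt⟩

/-- The complement in `B` of the ray that starts at `q` and passes through `p`, as a union of three
convex pieces. -/
def slit (B : Set Plane) (p q : Plane) : Set Plane :=
  leftPart B p q ∪ leftPart B q (q.1 + (q.2 - p.2), q.2 - (q.1 - p.1)) ∪ leftPart B q p

lemma slit_subset {B : Set Plane} {p q : Plane} : slit B p q ⊆ B :=
  union_subset (union_subset inter_subset_left inter_subset_left) inter_subset_left

lemma mem_slit {B : Set Plane} {p q x : Plane} (hx : x ∈ B) (h : signedArea p q x ≠ 0) :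
    x ∈ slit B p q :=
  (mem_leftPart_or_mem_leftPart_swap hx h).imp Or.inl id

lemma signedArea_normal (p q x : Plane) :
    signedArea q (q.1 + (q.2 - p.2), q.2 - (q.1 - p.1)) x =
      (q.1 - p.1) * (x.1 - q.1) + (q.2 - p.2) * (x.2 - q.2) := by
  unfold signedArea; ring

lemma disjoint_slit_segment (B : Set Plane) (p q : Plane) :
    Disjoint (slit B p q) (segment ℝ p q) := by
  refine ((disjoint_leftPart_segment B p q).union_left ?_).union_left
    (segment_symm ℝ p q ▸ disjoint_leftPart_segment B q p)
  refine disjoint_left.2 fun x hx hxs => ?_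
  obtain ⟨s, t, hs, ht, hst, rfl⟩ := hxs
  have h := hx.2
  rw [mem_ofPred_eq, signedArea_combo _ _ _ _ hst, signedArea_normal, signedArea_normal] at h
  nlinarith [mul_nonneg hs (sq_nonneg (q.1 - p.1)), mul_nonneg hs (sq_nonneg (q.2 - p.2))]

lemma isPreconnected_slit {B : Set Plane} (hBo : IsOpen B) (hBc : Convex ℝ B) {p q : Plane}
    (hpq : p ≠ q) (hq : q ∈ B) : IsPreconnected (slit B p q) := by
  set r : Plane := (q.1 + (q.2 - p.2), q.2 - (q.1 - p.1)) with hr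
  have hKo : IsOpen (leftPart B q r) :=
    hBo.inter (isOpen_lt continuous_const (continuous_signedArea q r))
  obtain ⟨z, hzK, hz0⟩ : ∃ z ∈ leftPart B q r, signedArea p q z = 0 := by
    have hc : Continuous fun t : ℝ => q + t • (q - p) := by fun_prop
    have hev : ∀ᶠ t : ℝ in 𝓝[>] 0, q + t • (q - p) ∈ B := by
      apply (hc.tendsto 0).mono_left nhdsWithin_le_nhds
      simpa using hBo.mem_nhds hq
    obtain ⟨t, htB, ht⟩ := (hev.and self_mem_nhdsWithin).exists
    refine ⟨_, ⟨htB, ?_⟩, ?_⟩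
    · rw [mem_ofPred_eq, hr, signedArea_normal]
      simp only [Prod.fst_add, Prod.snd_add, Prod.smul_fst, Prod.smul_snd, Prod.fst_sub,
        Prod.snd_sub, smul_eq_mul, add_sub_cancel_left]
      have := mul_pos ht (sq_add_sq_pos_of_ne hpq)
      linarith
    · simp only [signedArea, Prod.fst_add, Prod.snd_add, Prod.smul_fst, Prod.smul_snd,
        Prod.fst_sub, Prod.snd_sub, smul_eq_mul]
      ring
  obtain ⟨x, hxK, hx⟩ := exists_lt_signedArea hpq (hKo.mem_nhds hzK)
  obtain ⟨y, hyK, hy⟩ := exists_lt_signedArea hpq.symm (hKo.mem_nhds hzK)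
  rw [hz0] at hx
  rw [signedArea_swap p q z, hz0, neg_zero] at hy
  have hpre : ∀ a b : Plane, IsPreconnected (leftPart B a b) := fun a b =>
    (convex_leftPart hBc a b).isPreconnected
  exact IsPreconnected.union y (Or.inr hyK) ⟨hyK.1, hy⟩
    (IsPreconnected.union x ⟨hxK.1, hx⟩ hxK (hpre p q) (hpre q r)) (hpre q p)

lemma IsPreconnected.subset_or_disjoint_of_disjoint_frontier {X : Type*} [TopologicalSpace X]
    {s t : Set X} (hs : IsPreconnected s) (h : Disjoint s (frontier t)) :
    s ⊆ t ∨ Disjoint s t := by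
  have hcov : s ⊆ interior t ∪ (closure t)ᶜ := by
    intro x hx
    by_cases hc : x ∈ closure t
    · left
      by_contra hi
      exact disjoint_left.1 h hx ⟨hc, hi⟩
    · exact Or.inr hc
  have hdisj : s ∩ (interior t ∩ (closure t)ᶜ) = ∅ := by
    ext x
    simp only [mem_inter_iff, mem_compl_iff, mem_empty_iff_false, iff_false]
    exact fun hx => hx.2.2 (subset_closure (interior_subset hx.2.1))
  rcases isPreconnected_iff_subset_of_disjoint.1 hs _ _ isOpen_interior
    isClosed_closure.isOpen_compl hcov hdisj with h1 | h1
  · exact Or.inl (h1.trans interior_subset)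
  · exact Or.inr (disjoint_left.2 fun x hx hxt => h1 hx (subset_closure hxt))

namespace SimplePolygon

variable {n : ℕ} (SP : SimplePolygon n)

/-- The `i`-th closed edge. -/
def edge (i : ZMod n) : Set Plane := segment ℝ (SP.v i) (SP.v (i + 1))

/-- The `i`-th edge without its endpoints. -/
def openEdge (i : ZMod n) : Set Plane := openSegment ℝ (SP.v i) (SP.v (i + 1))

lemma isClosed_edge (i : ZMod n) : IsClosed (SP.edge i) := by
  rw [edge, ← closure_openSegment]
  exact isClosed_closure

lemma openEdge_subset_edge (i : ZMod n) : SP.openEdge i ⊆ SP.edge i :=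
  openSegment_subset_segment ..

lemma edge_subset_frontier (i : ZMod n) : SP.edge i ⊆ frontier SP.P := by
  rw [SP.frontier_eq]
  exact subset_iUnion (fun i => segment ℝ (SP.v i) (SP.v (i + 1))) i

lemma frontier_subset : frontier SP.P ⊆ SP.P := SP.compact.isClosed.frontier_subset

lemma v_ne_v_succ (i : ZMod n) : SP.v i ≠ SP.v (i + 1) := by
  have : Fact (1 < n) := ⟨by have := SP.three_le; omega⟩
  intro h
  have := SP.inj h
  simp at this

lemma v_notMem_openEdge {i : ZMod n} : SP.v i ∉ SP.openEdge i := by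
  intro h
  exact SP.v_ne_v_succ i (left_mem_openSegment_iff.1 h)

lemma v_succ_notMem_openEdge {i : ZMod n} : SP.v (i + 1) ∉ SP.openEdge i := by
  intro h
  exact SP.v_ne_v_succ i (right_mem_openSegment_iff.1 h)

lemma notMem_edge_of_mem_openEdge {i j : ZMod n} (hij : j ≠ i) {x : Plane}
    (hx : x ∈ SP.openEdge i) : x ∉ SP.edge j := by
  intro hxj
  have hxi := SP.openEdge_subset_edge i hx
  by_cases h1 : j = i + 1
  · subst h1
    have : x ∈ ({SP.v (i + 1)} : Set Plane) := by
      rw [← SP.edges_consecutive i]; exact ⟨hxi, hxj⟩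
    rw [mem_singleton_iff.1 this] at hx
    exact SP.v_succ_notMem_openEdge hx
  by_cases h2 : i = j + 1
  · subst h2
    have : x ∈ ({SP.v (j + 1)} : Set Plane) := by
      rw [← SP.edges_consecutive j]; exact ⟨hxj, hxi⟩
    rw [mem_singleton_iff.1 this] at hx
    exact SP.v_notMem_openEdge hx
  · exact disjoint_left.1 (SP.edges_disjoint i j hij.symm h1 h2) hxi hxj

lemma v_succ_notMem_edge {i j : ZMod n} (hi : j ≠ i) (hi' : j ≠ i + 1) :
    SP.v (i + 1) ∉ SP.edge j := by
  intro h
  by_cases h2 : i = j + 1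
  · subst h2
    refine disjoint_left.1 (SP.edges_disjoint (j + 1 + 1) j hi'.symm ?_ ?_)
      (left_mem_segment ..) h
    · intro h3
      have hc := SP.edges_consecutive (j + 1 + 1)
      rw [← h3] at hc
      have : SP.v (j + 1 + 1) ∈ ({SP.v j} : Set Plane) := by
        rw [← hc]; exact ⟨left_mem_segment .., h⟩
      refine SP.v_ne_v_succ (j + 1 + 1) ?_
      rw [← h3]; exact this
    · intro h3
      exact SP.v_ne_v_succ (j + 1) (by rw [h3])
  · exact disjoint_left.1 (SP.edges_disjoint i j hi.symm hi' h2) (right_mem_segment ..) h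

lemma neZero (SP : SimplePolygon n) : NeZero n := ⟨by have := SP.three_le; omega⟩

lemma mem_openEdge_of_mem_frontier {x : Plane} (hx : x ∈ frontier SP.P)
    (hv : x ∉ range SP.v) : ∃ i, x ∈ SP.openEdge i := by
  rw [SP.frontier_eq, mem_iUnion] at hx
  obtain ⟨i, hi⟩ := hx
  exact ⟨i, mem_openSegment_of_ne_left_right (fun h => hv ⟨i, h⟩) (fun h => hv ⟨i + 1, h⟩) hi⟩

lemma disjoint_frontier_of_forall_edge {s : Set Plane} (h : ∀ i, Disjoint s (SP.edge i)) :
    Disjoint s (frontier SP.P) := by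
  rw [SP.frontier_eq]
  exact disjoint_iUnion_right.2 h

/-- A point lying only on the edges indexed by `I` has arbitrarily small convex open
neighbourhoods that meet only these edges. -/
lemma exists_convex_nhd {x : Plane} {I : Set (ZMod n)} (hI : ∀ j ∉ I, x ∉ SP.edge j)
    {U : Set Plane} (hU : U ∈ 𝓝 x) :
    ∃ B ⊆ U, IsOpen B ∧ Convex ℝ B ∧ x ∈ B ∧ ∀ j ∉ I, Disjoint B (SP.edge j) := by
  have := SP.neZero
  have hclosed : IsClosed (⋃ j ∈ Iᶜ, SP.edge j) :=
    (toFinite Iᶜ).isClosed_biUnion fun j _ => SP.isClosed_edge j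
  have hx : x ∈ (⋃ j ∈ Iᶜ, SP.edge j)ᶜ := by
    simp only [mem_compl_iff, mem_iUnion, not_exists]
    exact hI
  obtain ⟨ε, hε, hsub⟩ := Metric.mem_nhds_iff.1
    (Filter.inter_mem hU (hclosed.isOpen_compl.mem_nhds hx))
  refine ⟨Metric.ball x ε, hsub.trans inter_subset_left, Metric.isOpen_ball, convex_ball x ε,
    Metric.mem_ball_self hε, fun j hj => disjoint_left.2 fun y hy hyj => (hsub hy).2 ?_⟩
  exact mem_biUnion (show j ∈ Iᶜ from hj) hyj

variable {SP}

/-- Near a point of an open edge on the frontier of `W`, one side is in `W`, the other in `P`. -/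
lemma exists_two_sided_nhd {W : Set Plane} (hWo : IsOpen W) (hWP : Disjoint W SP.P)
    (hWf : frontier W ⊆ frontier SP.P) {i : ZMod n} {x : Plane} (hxi : x ∈ SP.openEdge i)
    (hxW : x ∈ frontier W) {U : Set Plane} (hU : U ∈ 𝓝 x) :
    ∃ B ⊆ U, IsOpen B ∧ x ∈ B ∧ ∃ p q : Plane, p ≠ q ∧ segment ℝ p q = SP.edge i ∧
      (∀ y, signedArea p q y ≠ 0 → signedArea (SP.v i) (SP.v (i + 1)) y ≠ 0) ∧
      leftPart B p q ⊆ W ∧ leftPart B q p ⊆ SP.P := by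
  obtain ⟨B, hBU, hBo, hBc, hxB, hBe⟩ := SP.exists_convex_nhd (I := {i})
    (fun j hj => SP.notMem_edge_of_mem_openEdge hj hxi) hU
  refine ⟨B, hBU, hBo, hxB, ?_⟩
  have hside : ∀ p q : Plane, segment ℝ p q = SP.edge i →
      Disjoint (leftPart B p q) (frontier SP.P) := by
    intro p q hpq
    refine SP.disjoint_frontier_of_forall_edge fun j => ?_
    by_cases hj : j = i
    · subst hj; rw [← hpq]; exact disjoint_leftPart_segment B p q
    · exact (hBe j hj).mono_left inter_subset_left
  have hWside : ∀ p q : Plane, segment ℝ p q = SP.edge i →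
      leftPart B p q ⊆ W ∨ Disjoint (leftPart B p q) W := fun p q hpq =>
    (convex_leftPart hBc p q).isPreconnected.subset_or_disjoint_of_disjoint_frontier
      ((hside p q hpq).mono_right hWf)
  have hPside : ∀ p q : Plane, segment ℝ p q = SP.edge i →
      leftPart B p q ⊆ SP.P ∨ Disjoint (leftPart B p q) SP.P := fun p q hpq =>
    (convex_leftPart hBc p q).isPreconnected.subset_or_disjoint_of_disjoint_frontier
      (hside p q hpq)
  have hmeet : ∀ p q : Plane, p ≠ q → ∀ s : Set Plane, IsOpen s → (B ∩ s).Nonempty →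
      (∃ y ∈ s, y ∈ leftPart B p q) ∨ ∃ y ∈ s, y ∈ leftPart B q p := by
    intro p q hpq s hs hne
    obtain ⟨y, hy, hy0⟩ := exists_signedArea_ne_zero hpq (hBo.inter hs) hne
    exact (mem_leftPart_or_mem_leftPart_swap hy.1 hy0).imp (fun h => ⟨y, hy.2, h⟩)
      (fun h => ⟨y, hy.2, h⟩)
  have hmeetW : (B ∩ W).Nonempty := mem_closure_iff.1 hxW.1 B hBo hxB
  have hmeetP : (B ∩ interior SP.P).Nonempty := by
    refine mem_closure_iff.1 ?_ B hBo hxB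
    rw [← SP.regular]
    exact SP.frontier_subset (hWf hxW)
  have key : ∀ p q : Plane, p ≠ q → segment ℝ p q = SP.edge i →
      (∃ y ∈ W, y ∈ leftPart B p q) → leftPart B p q ⊆ W ∧ leftPart B q p ⊆ SP.P := by
    rintro p q hpq he ⟨y, hyW, hy⟩
    have h1 : leftPart B p q ⊆ W :=
      (hWside p q he).resolve_right fun h => disjoint_left.1 h hy hyW
    refine ⟨h1, (hPside q p (by rw [segment_symm, he])).resolve_right fun h => ?_⟩
    rcases hmeet p q hpq _ isOpen_interior hmeetP with ⟨z, hzP, hz⟩ | ⟨z, hzP, hz⟩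
    · exact disjoint_left.1 hWP (h1 hz) (interior_subset hzP)
    · exact disjoint_left.1 h hz (interior_subset hzP)
  have hne := SP.v_ne_v_succ i
  rcases hmeet _ _ hne W hWo hmeetW with h | h
  · exact ⟨_, _, hne, rfl, fun _ h => h, key _ _ hne rfl h⟩
  · exact ⟨_, _, hne.symm, segment_symm .., fun y hy => by
      rwa [signedArea_swap, neg_ne_zero] at hy, key _ _ hne.symm (segment_symm ..) h⟩

lemma openEdge_subset_frontier {W : Set Plane} (hWo : IsOpen W) (hWP : Disjoint W SP.P)
    (hWf : frontier W ⊆ frontier SP.P) {i : ZMod n} (h : (SP.openEdge i ∩ frontier W).Nonempty) :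
    SP.openEdge i ⊆ frontier W := by
  have hnW : ∀ x ∈ SP.openEdge i, x ∉ W := fun x hx hxW =>
    disjoint_left.1 hWP hxW
      (SP.frontier_subset (SP.edge_subset_frontier i (SP.openEdge_subset_edge i hx)))
  have hmem : ∀ x ∈ SP.openEdge i, x ∈ closure W → x ∈ frontier W := fun x hx hxc =>
    ⟨hxc, fun hi => hnW x hx (interior_subset hi)⟩
  have hcov : SP.openEdge i ⊆ (frontier W)ᶜ ∪ interior (closure W ∪ (SP.openEdge i)ᶜ) := by
    intro x hx
    by_cases hxW : x ∈ frontier W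
    · right
      obtain ⟨B, -, hBo, hxB, p, q, hpq, he, -, hBW, -⟩ :=
        exists_two_sided_nhd hWo hWP hWf hx hxW Filter.univ_mem
      refine mem_interior.2 ⟨B, fun y hy => ?_, hBo, hxB⟩
      by_cases hyi : y ∈ SP.openEdge i
      · refine Or.inl (closure_mono hBW (mem_closure_leftPart hBo hpq hy ?_))
        apply signedArea_eq_zero_of_mem_segment
        rw [he]
        exact SP.openEdge_subset_edge i hyi
      · exact Or.inr hyi
    · exact Or.inl hxW
  have hdisj : SP.openEdge i ∩ ((frontier W)ᶜ ∩ interior (closure W ∪ (SP.openEdge i)ᶜ)) = ∅ := by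
    refine eq_empty_of_forall_notMem fun x hx => hx.2.1 (hmem x hx.1 ?_)
    exact (interior_subset hx.2.2).resolve_right fun h => h hx.1
  obtain ⟨x, hxi, hxW⟩ := h
  rcases isPreconnected_iff_subset_of_disjoint.1 (convex_openSegment _ _).isPreconnected _ _
    isClosed_frontier.isOpen_compl isOpen_interior hcov hdisj with h1 | h1
  · exact absurd hxW (h1 hxi)
  · exact fun y hy => hmem y hy ((interior_subset (h1 hy)).resolve_right fun h => h hy)

lemma openEdge_succ_inter_frontier_nonempty {W : Set Plane} (hWo : IsOpen W) (hWP : Disjoint W SP.P)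
    (hWf : frontier W ⊆ frontier SP.P) {i : ZMod n} (h : SP.openEdge i ⊆ frontier W) :
    (SP.openEdge (i + 1) ∩ frontier W).Nonempty := by
  by_contra hemp
  rw [not_nonempty_iff_eq_empty] at hemp
  obtain ⟨B, hBv, hBo, hBc, hvB, hBe⟩ := SP.exists_convex_nhd (x := SP.v (i + 1)) (I := {i, i + 1})
    (fun j hj => by
      simp only [mem_insert_iff, mem_singleton_iff, not_or] at hj
      exact SP.v_succ_notMem_edge hj.1 hj.2)
    (U := {SP.v (i + 1 + 1)}ᶜ)
    (isOpen_compl_singleton.mem_nhds (SP.v_ne_v_succ (i + 1)))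
  set P₀ := SP.v i
  set Q₀ := SP.v (i + 1)
  have hne : P₀ ≠ Q₀ := SP.v_ne_v_succ i
  have hfr : ∀ x ∈ B, x ∈ frontier W → x ∈ SP.edge i := by
    intro x hxB hxW
    have hxP := hWf hxW
    rw [SP.frontier_eq, mem_iUnion] at hxP
    obtain ⟨j, hj⟩ := hxP
    by_cases h1 : j = i
    · rw [← h1]; exact hj
    by_cases h2 : j = i + 1
    · subst h2
      by_cases h3 : x = Q₀
      · rw [h3]; exact right_mem_segment ..
      · have : x ∈ SP.openEdge (i + 1) ∩ frontier W := by
          refine ⟨mem_openSegment_of_ne_left_right (Ne.symm h3) ?_ hj, hxW⟩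
          exact fun h => hBv hxB h.symm
        rw [hemp] at this
        exact this.elim
    · exact absurd hj (disjoint_left.1 (hBe j (by simp [h1, h2])) hxB)
  have hslit : ∀ y ∈ slit B P₀ Q₀, y ∉ frontier W := fun y hy hyW =>
    disjoint_left.1 (disjoint_slit_segment B P₀ Q₀) hy (hfr y (slit_subset hy) hyW)
  obtain ⟨x, hxB, hxi⟩ : (B ∩ SP.openEdge i).Nonempty := by
    refine mem_closure_iff.1 ?_ B hBo hvB
    rw [openEdge, closure_openSegment]
    exact right_mem_segment ..
  obtain ⟨B', hB', hB'o, hxB', p, q, hpq, he, hpi, hpW, hqP⟩ :=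
    exists_two_sided_nhd hWo hWP hWf hxi (h hxi) (hBo.mem_nhds hxB)
  have hx0 : signedArea p q x = 0 := by
    apply signedArea_eq_zero_of_mem_segment
    rw [he]
    exact SP.openEdge_subset_edge i hxi
  obtain ⟨y, hy⟩ : (leftPart B' p q).Nonempty :=
    closure_nonempty_iff.1 ⟨x, mem_closure_leftPart hB'o hpq hxB' hx0⟩
  obtain ⟨z, hz⟩ : (leftPart B' q p).Nonempty :=
    closure_nonempty_iff.1 ⟨x, mem_closure_leftPart hB'o hpq.symm hxB'
      (by rw [signedArea_swap, hx0, neg_zero])⟩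
  have hys : y ∈ slit B P₀ Q₀ := mem_slit (hB' hy.1) (hpi y hy.2.ne')
  have hzs : z ∈ slit B P₀ Q₀ := mem_slit (hB' hz.1) (hpi z (by
    rw [signedArea_swap, neg_ne_zero]; exact hz.2.ne'))
  rcases (isPreconnected_slit hBo hBc hne hvB).subset_or_disjoint_of_disjoint_frontier
    (disjoint_left.2 hslit) with h1 | h1
  · exact disjoint_left.1 hWP (h1 hzs) (hqP hz)
  · exact disjoint_left.1 h1 hys (hpW hy)

lemma openEdge_subset_frontier_of_notMem_range {W : Set Plane} (hWo : IsOpen W)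
    (hWP : Disjoint W SP.P) (hWf : frontier W ⊆ frontier SP.P) {x : Plane} (hx : x ∈ frontier W) (hv : x ∉ range SP.v)
    (i : ZMod n) : SP.openEdge i ⊆ frontier W := by
  have := SP.neZero
  obtain ⟨j, hj⟩ := SP.mem_openEdge_of_mem_frontier (hWf hx) hv
  have hall : ∀ k : ℕ, SP.openEdge (j + k) ⊆ frontier W := by
    intro k
    induction k with
    | zero =>
      rw [Nat.cast_zero, add_zero]
      exact openEdge_subset_frontier hWo hWP hWf ⟨x, hj, hx⟩
    | succ k ih =>
      rw [Nat.cast_succ, ← add_assoc]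
      exact openEdge_subset_frontier hWo hWP hWf
        (openEdge_succ_inter_frontier_nonempty hWo hWP hWf ih)
  have := hall (i - j).val
  rwa [ZMod.natCast_zmod_val, add_sub_cancel] at this

/-- An open set off `P` whose frontier lies on the boundary of `P` cannot be contained in an open
half-plane supported by a line that contains a nontrivial segment of `P`. -/
lemma eq_empty_of_subset_leftPart {W : Set Plane} (hWo : IsOpen W) (hWP : Disjoint W SP.P)
    (hWf : frontier W ⊆ frontier SP.P) {a b : Plane} (hab : a ≠ b) (hseg : segment ℝ a b ⊆ SP.P)
    (hW : W ⊆ {x | 0 < signedArea a b x}) : W = ∅ := by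
  have := SP.neZero
  by_contra hemp
  have hVfin : (range SP.v).Finite := finite_range _
  obtain ⟨q, hqs, hqv⟩ : ∃ q ∈ segment ℝ a b, q ∉ range SP.v := by
    have hinf : (segment ℝ a b).Infinite :=
      (convex_segment a b).isPreconnected.infinite_of_nontrivial
        ⟨a, left_mem_segment .., b, right_mem_segment .., hab⟩
    obtain ⟨q, hq⟩ := (hinf.sdiff hVfin).nonempty
    exact ⟨q, hq.1, hq.2⟩
  obtain ⟨x, hxW, hxv⟩ : ∃ x ∈ frontier W, x ∉ range SP.v := by
    by_contra! h
    have hconn : IsPreconnected (range SP.v)ᶜ :=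
      (hVfin.countable.isConnected_compl_of_one_lt_rank (by
        rw [rank_prod', Module.rank_self]; norm_num)).isPreconnected
    rcases hconn.subset_or_disjoint_of_disjoint_frontier
      (disjoint_left.2 fun y hy hyW => hy (h y hyW)) with h1 | h1
    · exact disjoint_left.1 hWP (h1 hqv) (hseg hqs)
    · obtain ⟨w, hw⟩ := nonempty_iff_ne_empty.2 hemp
      have hinf : W.Infinite := infinite_of_mem_nhds w (hWo.mem_nhds hw)
      obtain ⟨y, hyW, hyv⟩ := (hinf.sdiff hVfin).nonempty
      exact disjoint_left.1 h1 hyv hyW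
  have hall := openEdge_subset_frontier_of_notMem_range hWo hWP hWf hxW hxv
  have hcl : closure W ⊆ {x | 0 ≤ signedArea a b x} :=
    closure_minimal (fun x hx => le_of_lt (show 0 < signedArea a b x from hW hx))
      (isClosed_le continuous_const (continuous_signedArea a b))
  have hint : ∀ x ∈ interior SP.P, ∃ y ∈ SP.P, signedArea a b y < signedArea a b x := by
    intro x hx
    obtain ⟨y, hy, hlt⟩ := exists_lt_signedArea hab.symm (mem_interior_iff_mem_nhds.1 hx)
    rw [signedArea_swap a b, signedArea_swap a b] at hlt
    exact ⟨y, hy, neg_lt_neg_iff.1 hlt⟩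
  have hPnonneg : ∀ x ∈ SP.P, 0 ≤ signedArea a b x := by
    obtain ⟨m, hmP, hm⟩ := SP.compact.exists_isMinOn ⟨q, hseg hqs⟩
      (continuous_signedArea a b).continuousOn
    have hmf : m ∈ frontier SP.P := by
      refine ⟨subset_closure hmP, fun hmi => ?_⟩
      obtain ⟨y, hy, hlt⟩ := hint m hmi
      exact (hm hy).not_gt hlt
    rw [SP.frontier_eq, mem_iUnion] at hmf
    obtain ⟨j, hj⟩ := hmf
    have hmc : m ∈ closure W := by
      rw [← closure_openSegment] at hj
      exact closure_minimal ((hall j).trans frontier_subset_closure) isClosed_closure hj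
    exact fun x hx => (hcl hmc).trans (hm hx)
  have hq0 : signedArea a b q = 0 := signedArea_eq_zero_of_mem_segment hqs
  have hqf : q ∈ frontier SP.P := by
    refine ⟨subset_closure (hseg hqs), fun hqi => ?_⟩
    obtain ⟨y, hy, hlt⟩ := hint q hqi
    have := hPnonneg y hy
    linarith
  obtain ⟨i, hi⟩ := SP.mem_openEdge_of_mem_frontier hqf hqv
  obtain ⟨B, -, hBo, hqB, p, r, hpr, -, -, hBW, hBP⟩ :=
    exists_two_sided_nhd hWo hWP hWf hi (hall i hi) Filter.univ_mem
  have hneg : IsOpen (B ∩ {x | signedArea a b x < 0}) :=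
    hBo.inter (isOpen_lt (continuous_signedArea a b) continuous_const)
  obtain ⟨y, hyB, hy⟩ := exists_lt_signedArea hab.symm (hBo.mem_nhds hqB)
  rw [signedArea_swap a b, signedArea_swap a b, neg_lt_neg_iff, hq0] at hy
  obtain ⟨z, hz, hz0⟩ := exists_signedArea_ne_zero hpr hneg ⟨y, hyB, hy⟩
  rcases mem_leftPart_or_mem_leftPart_swap hz.1 hz0 with h | h
  · exact lt_asymm (show 0 < signedArea a b z from hW (hBW h)) hz.2
  · exact not_lt_of_ge (hPnonneg z (hBP h)) hz.2

end SimplePolygon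

lemma SimplePolygon.convexHull_subset_of_signedArea_pos {n : ℕ} (SP : SimplePolygon n)
    {a b c : Plane} (hD : 0 < signedArea a b c) (hab : segment ℝ a b ⊆ SP.P)
    (hbc : segment ℝ b c ⊆ SP.P) (hca : segment ℝ c a ⊆ SP.P) :
    convexHull ℝ ({a, b, c} : Set Plane) ⊆ SP.P := by
  have hDb : 0 < signedArea b c a := by unfold signedArea at *; linarith
  have hDc : 0 < signedArea c a b := by unfold signedArea at *; linarith
  have hconv : ∀ p q : Plane, Convex ℝ {x | 0 ≤ signedArea p q x} := by
    intro p q x hx y hy s t hs ht hst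
    simp only [mem_ofPred_eq] at *
    rw [signedArea_combo p q x y hst]
    positivity
  have hself : ∀ p q : Plane, signedArea p q p = 0 ∧ signedArea p q q = 0 := fun p q =>
    ⟨by unfold signedArea; ring, by unfold signedArea; ring⟩
  have hT : convexHull ℝ ({a, b, c} : Set Plane) ⊆ {x | 0 ≤ signedArea a b x} ∩
      ({x | 0 ≤ signedArea b c x} ∩ {x | 0 ≤ signedArea c a x}) := by
    refine convexHull_min ?_ ((hconv a b).inter ((hconv b c).inter (hconv c a)))
    rintro x (rfl | rfl | rfl) <;> simp [hself, hD.le, hDb.le, hDc.le]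
  have hboundary : ∀ x, 0 ≤ signedArea a b x → 0 ≤ signedArea b c x → 0 ≤ signedArea c a x →
      x ∉ SP.P → 0 < signedArea a b x ∧ 0 < signedArea b c x ∧ 0 < signedArea c a x := by
    intro x h1 h2 h3 hx
    refine ⟨h1.lt_of_ne' fun h => hx (hab ?_), h2.lt_of_ne' fun h => hx (hbc ?_),
      h3.lt_of_ne' fun h => hx (hca ?_)⟩
    · exact mem_segment_of_signedArea_eq_zero hD h h2 h3
    · exact mem_segment_of_signedArea_eq_zero hDb h h3 h1
    · exact mem_segment_of_signedArea_eq_zero hDc h h1 h2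
  set W : Set Plane := SP.Pᶜ ∩ ({x | 0 < signedArea a b x} ∩
    ({x | 0 < signedArea b c x} ∩ {x | 0 < signedArea c a x}))
  have hopen : ∀ p q : Plane, IsOpen {x | 0 < signedArea p q x} := fun p q =>
    isOpen_lt continuous_const (continuous_signedArea p q)
  have hclosed : ∀ p q : Plane, IsClosed {x | 0 ≤ signedArea p q x} := fun p q =>
    isClosed_le continuous_const (continuous_signedArea p q)
  have hle : ∀ p q : Plane, {x | 0 < signedArea p q x} ⊆ {x | 0 ≤ signedArea p q x} :=
    fun p q x (hx : 0 < signedArea p q x) => show 0 ≤ signedArea p q x from hx.le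
  have hWo : IsOpen W := SP.compact.isClosed.isOpen_compl.inter
    ((hopen a b).inter ((hopen b c).inter (hopen c a)))
  have hWP : Disjoint W SP.P := disjoint_left.2 fun _ hx => hx.1
  have hWf : frontier W ⊆ frontier SP.P := by
    intro x hx
    rw [hWo.frontier_eq] at hx
    have hxT : x ∈ {x | 0 ≤ signedArea a b x} ∩
        ({x | 0 ≤ signedArea b c x} ∩ {x | 0 ≤ signedArea c a x}) :=
      closure_minimal (inter_subset_right.trans (inter_subset_inter (hle a b)
        (inter_subset_inter (hle b c) (hle c a))))
        ((hclosed a b).inter ((hclosed b c).inter (hclosed c a))) hx.1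
    have hxP : x ∈ SP.P := by
      by_contra hxP
      exact hx.2 ⟨hxP, hboundary x hxT.1 hxT.2.1 hxT.2.2 hxP⟩
    rw [frontier_eq_closure_inter_closure]
    exact ⟨subset_closure hxP, closure_mono inter_subset_left hx.1⟩
  have hne : a ≠ b := by
    rintro rfl
    unfold signedArea at hD
    simp at hD
  have hemp : W = ∅ := SimplePolygon.eq_empty_of_subset_leftPart hWo hWP hWf hne hab
    fun _ hx => hx.2.1
  intro x hx
  by_contra hxP
  obtain ⟨h1, h2, h3⟩ := hT hx
  have : x ∈ W := ⟨hxP, hboundary x h1 h2 h3 hxP⟩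
  rw [hemp] at this
  exact this

/-- If three distinct vertices of a simple polygon are mutually visible to each other,
then the solid triangle they span is entirely contained in the polygon. -/
theorem triangle_of_mutually_visible_subset {n : ℕ} (SP : SimplePolygon n)
    (a b c : ZMod n) (hab : a ≠ b) (hac : a ≠ c) (hbc : b ≠ c)
    (hvab : Visible SP.P (SP.v a) (SP.v b))
    (hvac : Visible SP.P (SP.v a) (SP.v c))
    (hvbc : Visible SP.P (SP.v b) (SP.v c)) :
    convexHull ℝ ({SP.v a, SP.v b, SP.v c} : Set Plane) ⊆ SP.P := by
  have hD := signedArea_ne_zero_of_not_collinear (SP.inj.ne hab)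
    (SP.no_three_collinear a b c hab hac hbc)
  unfold Visible at hvab hvac hvbc
  rcases hD.lt_or_gt with h | h
  · have h' : 0 < signedArea (SP.v b) (SP.v a) (SP.v c) := by rw [signedArea_swap]; linarith
    rw [insert_comm]
    exact SP.convexHull_subset_of_signedArea_pos h' (by rwa [segment_symm]) hvac
      (by rwa [segment_symm])
  · exact SP.convexHull_subset_of_signedArea_pos h hvab hvbc (by rwa [segment_symm])
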